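/- arXiv:2304.10793 — 2 statements merged into one kernel-verified Lean document; each statement's English description precedes it below -/
import Mathlib

section
/- Let G be a finite abelian group, let I be a finite nonempty indexing set, and let (H_i)_{i∈I} be subgroups of G. Then for every 1-bounded function f : G → ℂ, ( E_{i∈I} ‖f‖_{H_i}^2 )^2 ≤ E_{i,i'∈I} ‖f‖_{H_i + H_{i'}}^2. -/
open Finset Polynomial
open scoped BigOperators

noncomputable section


/-- The average of a complex-valued function over a finite type. -/
def eavg {α : Type*} [Finite α] (f : α → ℂ) : ℂ :=
  haveI := Fintype.ofFinite α
  (∑ x, f x) / (Nat.card α : ℂ)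

/-- The average of a real-valued function over a finite type. -/
def eavgR {α : Type*} [Finite α] (f : α → ℝ) : ℝ :=
  haveI := Fintype.ofFinite α
  (∑ x, f x) / (Nat.card α : ℝ)

/-- Iterated complex conjugation `C^n`. -/
def conjIter (n : ℕ) (z : ℂ) : ℂ := if Even n then z else (starRingEnd ℂ) z

/-- The weight `|ε|` of a Boolean vector. -/
def epsWt {ι : Type*} [Finite ι] (ε : ι → Bool) : ℕ :=
  haveI := Fintype.ofFinite ι
  ∑ i, if ε i then 1 else 0

/-- The Gowers box norm of `f` along a finite family of subgroups of `G`. -/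
def boxNorm {G : Type*} [AddCommGroup G] [Finite G] {ι : Type*} [Finite ι]
    (H : ι → AddSubgroup G) (f : G → ℂ) : ℝ :=
  haveI := Fintype.ofFinite ι
  haveI : Fintype (ι → Bool) := Fintype.ofFinite _
  ((eavg fun x : G => eavg fun h : ∀ i, H i =>
      ∏ ε : ι → Bool,
        conjIter (epsWt ε) (f (x + ∑ i, if ε i then (h i : G) else 0))).re) ^
    ((1 : ℝ) / 2 ^ Nat.card ι)

/-- Reduction of an integer vector modulo `p`. -/
def redv (p : ℕ) {D : ℕ} (w : Fin D → ℤ) : Fin D → ZMod p := fun k => (w k : ZMod p)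

/-- The vector `v·P(n)` in `F_p^D`. -/
def pshift (p : ℕ) {D : ℕ} (v : Fin D → ℤ) (P : Polynomial ℤ) (n : ZMod p) :
    Fin D → ZMod p :=
  fun k => (v k : ZMod p) * Polynomial.aeval n P

/-- The Gowers norm of degree `s` of `f` along the direction `v`. -/
def gowersU (p : ℕ) [NeZero p] {D : ℕ} (s : ℕ) (v : Fin D → ℤ)
    (f : (Fin D → ZMod p) → ℂ) : ℝ :=
  (eavg fun x : Fin D → ZMod p => eavg fun h : Fin s → ZMod p =>
      ∏ ε : Fin s → Bool,
        conjIter (epsWt ε)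
          (f (x + fun k => (∑ i, if ε i then h i else 0) * (v k : ZMod p)))).re ^
    ((1 : ℝ) / 2 ^ s)

/-- The conditional expectation `E(f | v)`. -/
def condAvg (p : ℕ) [NeZero p] {D : ℕ} (v : Fin D → ℤ)
    (f : (Fin D → ZMod p) → ℂ) (x : Fin D → ZMod p) : ℂ :=
  eavg fun n : ZMod p => f (x + fun k => n * (v k : ZMod p))

/-- The additive character `e_p`. -/
def ep (p : ℕ) (t : ZMod p) : ℂ :=
  Complex.exp (2 * Real.pi * Complex.I * (t.val : ℂ) / (p : ℂ))

/-- `χ` is an eigenfunction of the direction `v`. -/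
def IsEigenfunction (p : ℕ) {D : ℕ} (v : Fin D → ℤ) (χ : (Fin D → ZMod p) → ℂ) : Prop :=
  ∃ φ : (Fin D → ZMod p) → ZMod p,
    (∀ x, ‖χ x‖ = 0 ∨ ‖χ x‖ = 1) ∧
    (∀ x, χ (x + redv p v) = ep p (φ x) * χ x) ∧
    (∀ x, φ (x + redv p v) = φ x)

/-- The degree-`s'` dual function of `g` along `v`. -/
def dualFn (p : ℕ) [NeZero p] {D : ℕ} (s' : ℕ) (v : Fin D → ℤ)
    (g : (Fin D → ZMod p) → ℂ) (x : Fin D → ZMod p) : ℂ :=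
  eavg fun h : Fin s' → ZMod p =>
    ∏ ε ∈ Finset.univ.filter (fun ε : Fin s' → Bool => ε ≠ fun _ => false),
      conjIter (epsWt ε)
        (g (x + fun k => (∑ i, if ε i then h i else 0) * (v k : ZMod p)))

/-- Membership in `𝔇_s(v)`. -/
def MemDual (p : ℕ) [NeZero p] {D : ℕ} (s : ℕ) (v : Fin D → ℤ)
    (Df : (Fin D → ZMod p) → ℂ) : Prop :=
  ∃ (s' : ℕ) (g : (Fin D → ZMod p) → ℂ),
    1 ≤ s' ∧ s' ≤ s ∧ (∀ x, ‖g x‖ ≤ 1) ∧ Df = dualFn p s' v g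


open scoped ComplexConjugate

section Averages

variable {α β : Type*} [Finite α] [Finite β]

theorem eavg_eq_sum_div_card [Fintype α] (f : α → ℂ) :
    eavg f = (∑ x, f x) / (Fintype.card α : ℂ) := by
  rw [eavg, Nat.card_eq_fintype_card]
  congr!

theorem eavgR_eq_sum_div_card [Fintype α] (f : α → ℝ) :
    eavgR f = (∑ x, f x) / (Fintype.card α : ℝ) := by
  rw [eavgR, Nat.card_eq_fintype_card]
  congr!

theorem eavg_equiv (e : α ≃ β) (f : β → ℂ) : (eavg fun a => f (e a)) = eavg f := by
  have := Fintype.ofFinite α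
  have := Fintype.ofFinite β
  rw [eavg_eq_sum_div_card, eavg_eq_sum_div_card, Fintype.card_congr e, Equiv.sum_comp e f]

theorem eavg_const [Nonempty α] (c : ℂ) : (eavg fun _ : α => c) = c := by
  have := Fintype.ofFinite α
  rw [eavg_eq_sum_div_card]
  simp

theorem eavg_comm (f : α → β → ℂ) :
    (eavg fun a => eavg fun b => f a b) = eavg fun b => eavg fun a => f a b := by
  have := Fintype.ofFinite α
  have := Fintype.ofFinite β
  simp only [eavg_eq_sum_div_card, ← Finset.sum_div]
  rw [Finset.sum_comm, div_right_comm]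

theorem eavg_prod (f : α × β → ℂ) :
    eavg f = eavg fun a => eavg fun b => f (a, b) := by
  have := Fintype.ofFinite α
  have := Fintype.ofFinite β
  simp only [eavg_eq_sum_div_card, ← Finset.sum_div]
  rw [Fintype.sum_prod_type, Fintype.card_prod, Nat.cast_mul, div_div, mul_comm]

theorem mul_eavg (c : ℂ) (f : α → ℂ) : c * eavg f = eavg fun a => c * f a := by
  have := Fintype.ofFinite α
  simp only [eavg_eq_sum_div_card, ← Finset.mul_sum, mul_div_assoc]

theorem eavg_mul (f : α → ℂ) (c : ℂ) : eavg f * c = eavg fun a => f a * c := by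
  simp only [mul_comm _ c, mul_eavg]

theorem conj_eavg (f : α → ℂ) : conj (eavg f) = eavg fun a => conj (f a) := by
  have := Fintype.ofFinite α
  simp [eavg_eq_sum_div_card]

theorem re_eavg (f : α → ℂ) : (eavg f).re = eavgR fun a => (f a).re := by
  have := Fintype.ofFinite α
  rw [eavg_eq_sum_div_card, eavgR_eq_sum_div_card, Complex.div_natCast_re, Complex.re_sum]

theorem eavgR_mono {f g : α → ℝ} (h : ∀ a, f a ≤ g a) : eavgR f ≤ eavgR g := by
  have := Fintype.ofFinite α
  rw [eavgR_eq_sum_div_card, eavgR_eq_sum_div_card]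
  gcongr
  exact h _

theorem eavgR_nonneg {f : α → ℝ} (h : ∀ a, 0 ≤ f a) : 0 ≤ eavgR f := by
  have := Fintype.ofFinite α
  rw [eavgR_eq_sum_div_card]
  have := Finset.sum_nonneg fun a (_ : a ∈ Finset.univ) => h a
  positivity

theorem sq_eavgR_le (f : α → ℝ) : eavgR f ^ 2 ≤ eavgR fun a => f a ^ 2 := by
  have := Fintype.ofFinite α
  rw [eavgR_eq_sum_div_card, eavgR_eq_sum_div_card]
  rcases isEmpty_or_nonempty α with _ | _
  · simp
  · have hcard : (0 : ℝ) < Fintype.card α := by exact_mod_cast Fintype.card_pos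
    rw [div_pow, div_le_div_iff₀ (by positivity) hcard]
    have := sq_sum_le_card_mul_sum_sq (s := Finset.univ) (f := f)
    rw [Finset.card_univ] at this
    nlinarith [mul_le_mul_of_nonneg_right this hcard.le]

theorem eavg_mul_conj_self (f : α → ℂ) :
    (eavg fun a => f a * conj (f a)).re = eavgR fun a => ‖f a‖ ^ 2 := by
  rw [re_eavg]
  congr! 2 with a
  rw [Complex.mul_conj, Complex.ofReal_re, Complex.normSq_eq_norm_sq]

theorem sq_re_eavg_mul_conj_le {f : α → ℂ} (hf : ∀ a, ‖f a‖ ≤ 1) (g : α → ℂ)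
    (h0 : 0 ≤ (eavg fun a => f a * conj (g a)).re) :
    (eavg fun a => f a * conj (g a)).re ^ 2 ≤ (eavg fun a => g a * conj (g a)).re := by
  rw [eavg_mul_conj_self]
  refine le_trans (pow_le_pow_left₀ h0 ?_ 2) (sq_eavgR_le fun a => ‖g a‖)
  rw [re_eavg]
  refine eavgR_mono fun a => (Complex.re_le_norm _).trans ?_
  rw [norm_mul, RCLike.norm_conj]
  exact mul_le_of_le_one_left (norm_nonneg _) (hf a)

end Averages

theorem eavg_comp_addMonoidHom {A B : Type*} [AddCommGroup A] [AddCommGroup B] [Finite A]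
    [Finite B] (φ : A →+ B) (hφ : Function.Surjective φ) (F : B → ℂ) :
    (eavg fun a => F (φ a)) = eavg F := by
  have shift (b : B) : (eavg fun a => F (φ a + b)) = eavg fun a => F (φ a) := by
    obtain ⟨c, rfl⟩ := hφ b
    simp only [← map_add]
    exact eavg_equiv (Equiv.addRight c) fun a => F (φ a)
  calc (eavg fun a => F (φ a)) = eavg fun b => eavg fun a => F (φ a + b) := by
        simp only [shift, eavg_const]
    _ = eavg fun a => eavg fun b => F (φ a + b) := eavg_comm _
    _ = eavg fun _ : A => eavg F := by
        congr! 2 with a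
        exact eavg_equiv (Equiv.addLeft (φ a)) F
    _ = eavg F := eavg_const _

section SubgroupAverage

variable {G : Type*} [AddCommGroup G] [Finite G]

/-- The average of `f` over the cosets of a subgroup `H`. -/
def subgroupAvg (H : AddSubgroup G) (f : G → ℂ) (x : G) : ℂ := eavg fun h : H => f (x + h)

theorem subgroupAvg_subgroupAvg (H K : AddSubgroup G) (f : G → ℂ) :
    subgroupAvg H (subgroupAvg K f) = subgroupAvg (H ⊔ K) f := by
  ext x
  let φ : H × K →+ (H ⊔ K : AddSubgroup G) :=
    (AddSubgroup.inclusion le_sup_left).coprod (AddSubgroup.inclusion le_sup_right)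
  have hφ : Function.Surjective φ := by
    rintro ⟨s, hs⟩
    obtain ⟨h, k, rfl⟩ := AddSubgroup.mem_sup'.1 hs
    exact ⟨(h, k), rfl⟩
  simp only [subgroupAvg]
  rw [← eavg_comp_addMonoidHom φ hφ, eavg_prod]
  simp [φ, add_assoc]

theorem eavg_subgroupAvg_mul_conj (H : AddSubgroup G) (f g : G → ℂ) :
    (eavg fun x => subgroupAvg H f x * conj (g x)) =
      eavg fun x => f x * conj (subgroupAvg H g x) := by
  simp only [subgroupAvg, conj_eavg, mul_eavg, eavg_mul]
  rw [eavg_comm, eavg_comm (α := G), ← eavg_equiv (Equiv.neg H)]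
  congr! 2 with h
  rw [← eavg_equiv (Equiv.addRight (h : G))]
  simp

theorem re_eavg_mul_conj_subgroupAvg_nonneg (H : AddSubgroup G) (f : G → ℂ) :
    0 ≤ (eavg fun x => f x * conj (subgroupAvg H f x)).re := by
  have h := eavg_subgroupAvg_mul_conj H f (subgroupAvg H f)
  rw [subgroupAvg_subgroupAvg, sup_idem] at h
  rw [← h, eavg_mul_conj_self]
  exact eavgR_nonneg fun _ => sq_nonneg _

theorem boxNorm_fin_one_sq (H : AddSubgroup G) (f : G → ℂ) :
    boxNorm (fun _ : Fin 1 => H) f ^ 2 =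
      (eavg fun x => f x * conj (subgroupAvg H f x)).re := by
  have key (x : G) (h : Fin 1 → H) (_ : Fintype (Fin 1)) (_ : Fintype (Fin 1 → Bool)) :
      (∏ ε : Fin 1 → Bool,
        conjIter (epsWt ε) (f (x + ∑ i, if ε i then (h i : G) else 0))) =
      f x * conj (f (x + h 0)) := by
    rw [← (Equiv.funUnique (Fin 1) Bool).symm.prod_comp]
    simp [conjIter, epsWt, mul_comm]
  have havg (x : G) : (eavg fun h : Fin 1 → H => f x * conj (f (x + h 0))) =
      f x * conj (subgroupAvg H f x) := by
    rw [subgroupAvg, conj_eavg, mul_eavg]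
    exact eavg_equiv (Equiv.funUnique (Fin 1) H) fun h => f x * conj (f (x + h))
  simp only [boxNorm, key, havg, Nat.card_unique, pow_one]
  rw [← Real.sqrt_eq_rpow, Real.sq_sqrt (re_eavg_mul_conj_subgroupAvg_nonneg H f)]

end SubgroupAverage

/-- Lemma 2.2, concatenation of degree-1 box norms:
`(E_{i∈I} ‖f‖_{H_i}²)² ≤ E_{i,i'∈I} ‖f‖_{H_i+H_{i'}}²`. -/
theorem statement3 {G : Type*} [AddCommGroup G] [Finite G]
    {I : Type*} [Finite I] [Nonempty I]
    (H : I → AddSubgroup G) (f : G → ℂ) (hf : ∀ x, ‖f x‖ ≤ 1) :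
    (eavgR fun i : I => boxNorm (fun _ : Fin 1 => H i) f ^ 2) ^ 2 ≤
      eavgR fun ii : I × I => boxNorm (fun _ : Fin 1 => H ii.1 ⊔ H ii.2) f ^ 2 := by
  have hleft : (eavgR fun i : I => boxNorm (fun _ : Fin 1 => H i) f ^ 2) =
      (eavg fun x => f x * conj (eavg fun i => subgroupAvg (H i) f x)).re := by
    simp only [boxNorm_fin_one_sq, ← re_eavg, conj_eavg, mul_eavg]
    rw [eavg_comm]
  have hright : (eavgR fun ii : I × I => boxNorm (fun _ : Fin 1 => H ii.1 ⊔ H ii.2) f ^ 2) =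
      (eavg fun x => (eavg fun i => subgroupAvg (H i) f x) *
        conj (eavg fun i => subgroupAvg (H i) f x)).re := by
    simp only [boxNorm_fin_one_sq, ← re_eavg, ← subgroupAvg_subgroupAvg]
    rw [eavg_prod]
    simp only [conj_eavg, mul_eavg, eavg_mul]
    rw [eavg_comm, eavg_comm (α := G)]
    congr! 3 with i
    rw [eavg_comm (α := G)]
    congr! 2 with j
    exact (eavg_subgroupAvg_mul_conj _ _ _).symm
  rw [hright, hleft]
  refine sq_re_eavg_mul_conj_le hf _ ?_
  rw [← hleft]
  exact eavgR_nonneg fun _ => sq_nonneg _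

end
end

section
/- Let s ∈ ℕ, let G be a finite abelian group, let I be a finite nonempty indexing set, and for each i ∈ I let H_{i1}, …, H_{is} be subgroups of G. There exists t ∈ ℕ depending only on s such that for every 1-bounded function f : G → ℂ, ( E_{i∈I} ‖f‖_{H_{i1}, …, H_{is}}^{2^s} )^t ≤ E over all families (i_ε)_{ε∈{0,1}^s} ∈ I^{{0,1}^s} of the box norm of f along the family of subgroups H_{i_ε j} + H_{i_{ε'} j}, indexed by j ∈ {1,…,s} and by those pairs ε, ε' ∈ {0,1}^s satisfying (ε_1,…,ε_{s−j}) = (ε'_1,…,ε'_{s−j}) and ε_{s+1−j} ≠ ε'_{s+1−j}. -/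
open Finset Polynomial
open scoped BigOperators

noncomputable section


/-- The condition on the pair `(ε, ε')` attached to the coordinate `j` (0-indexed; the paper's
`j ∈ [s]` corresponds to `j+1`): the first `s - (j+1)` coordinates of `ε, ε'` agree and the
coordinate in position `s + 1 - (j+1)` (1-indexed) differs. -/
def goodPair (s : ℕ) (j : Fin s) (ε ε' : Fin s → Bool) : Prop :=
  (∀ k : Fin s, (k : ℕ) + (j : ℕ) + 2 ≤ s → ε k = ε' k) ∧
  (∀ k : Fin s, (k : ℕ) + (j : ℕ) + 1 = s → ε k ≠ ε' k)

open scoped ComplexConjugate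

/-! ### Averages over finite types -/

section Averages

variable {α β : Type*} [Fintype α] [Fintype β]

lemma eavg_eq_expect (f : α → ℂ) : eavg f = 𝔼 x, f x := by
  rw [Fintype.expect_eq_sum_div_card, eavg, Nat.card_eq_fintype_card]
  congr!

lemma eavgR_eq_expect (f : α → ℝ) : eavgR f = 𝔼 x, f x := by
  rw [Fintype.expect_eq_sum_div_card, eavgR, Nat.card_eq_fintype_card]
  congr!

lemma expect_prod {M : Type*} [AddCommMonoid M] [Module ℚ≥0 M] (f : α × β → M) :
    𝔼 z, f z = 𝔼 a, 𝔼 b, f (a, b) := by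
  rw [← univ_product_univ, expect_product]

lemma expect_pow_le_expect_pow [Nonempty α] (f : α → ℝ) (hf : ∀ x, 0 ≤ f x) (n : ℕ) :
    (𝔼 x, f x) ^ n ≤ 𝔼 x, f x ^ n := by
  have key := Real.pow_arith_mean_le_arith_mean_pow univ
    (fun _ : α => (Fintype.card α : ℝ)⁻¹) f (fun _ _ => by positivity) (by simp)
    (fun x _ => hf x) n
  simpa [Fintype.expect_eq_sum_div_card, ← mul_sum, div_eq_inv_mul] using key

lemma norm_expect_le_expect_norm (f : α → ℂ) : ‖𝔼 x, f x‖ ≤ 𝔼 x, ‖f x‖ :=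
  RCLike.norm_expect_le (K := ℂ)

lemma norm_expect_pow_le [Nonempty α] (f : α → ℂ) (n : ℕ) :
    ‖𝔼 x, f x‖ ^ n ≤ 𝔼 x, ‖f x‖ ^ n :=
  (pow_le_pow_left₀ (norm_nonneg _) (norm_expect_le_expect_norm f) n).trans
    (expect_pow_le_expect_pow _ (fun _ => norm_nonneg _) n)

lemma ofReal_expect (f : α → ℝ) : ((𝔼 x, f x : ℝ) : ℂ) = 𝔼 x, (f x : ℂ) := by
  rw [Fintype.expect_eq_sum_div_card, Fintype.expect_eq_sum_div_card]
  push_cast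
  rfl

lemma conj_expect (f : α → ℂ) : conj (𝔼 x, f x) = 𝔼 x, conj (f x) := by
  rw [Fintype.expect_eq_sum_div_card, Fintype.expect_eq_sum_div_card]
  simp

lemma norm_expect_le_one [Nonempty α] (f : α → ℂ) (hf : ∀ x, ‖f x‖ ≤ 1) : ‖𝔼 x, f x‖ ≤ 1 :=
  (norm_expect_le_expect_norm f).trans (expect_le univ_nonempty fun x _ => hf x)

/-- The expansion of the second moment of the averages of `f` along the orbits of an action `σ`
of a finite group. -/
lemma expect_correlation_eq {T : Type*} [AddGroup T] [Fintype T] (σ : T → Equiv.Perm α)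
    (hσ : ∀ t t' z, σ (t' + t) z = σ t' (σ t z)) (f : α → ℂ) :
    𝔼 t, 𝔼 z, f z * conj (f (σ t z)) = ((𝔼 z, ‖𝔼 t, f (σ t z)‖ ^ 2 : ℝ) : ℂ) := by
  rw [ofReal_expect]
  have h1 : ∀ z, ((‖𝔼 t, f (σ t z)‖ ^ 2 : ℝ) : ℂ) =
      𝔼 t, 𝔼 t', f (σ t z) * conj (f (σ t' (σ t z))) := by
    intro z
    rw [← Complex.normSq_eq_norm_sq, ← Complex.mul_conj, conj_expect, Fintype.expect_mul_expect]
    refine expect_congr rfl fun t _ => ?_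
    refine (Fintype.expect_equiv (Equiv.addRight t) _ _ fun t' => ?_).symm
    rw [Equiv.coe_addRight, hσ]
  simp_rw [h1]
  rw [expect_comm univ univ fun z t => 𝔼 t', f (σ t z) * conj (f (σ t' (σ t z))),
    ← Fintype.expect_const (ι := T) (𝔼 t, 𝔼 z, f z * conj (f (σ t z)))]
  refine expect_congr rfl fun t _ => ?_
  conv_rhs => rw [expect_comm]
  refine expect_congr rfl fun t' _ => ?_
  exact Fintype.expect_equiv (σ t).symm _ _ fun z => by simp

/-- Cauchy-Schwarz eliminating a bounded weight which is invariant under an action `σ` of a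
finite group. -/
lemma norm_expect_sq_le_correlation [Nonempty α] {T : Type*} [AddGroup T] [Fintype T]
    (σ : T → Equiv.Perm α)
    (hσ : ∀ t t' z, σ (t' + t) z = σ t' (σ t z)) (w f : α → ℂ) (hw : ∀ z, ‖w z‖ ≤ 1)
    (hwσ : ∀ t z, w (σ t z) = w z) :
    ‖𝔼 z, w z * f z‖ ^ 2 ≤ ‖𝔼 t, 𝔼 z, f z * conj (f (σ t z))‖ := by
  have h1 : 𝔼 z, w z * f z = 𝔼 z, w z * 𝔼 t, f (σ t z) := by
    simp_rw [mul_expect]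
    rw [expect_comm, ← Fintype.expect_const (ι := T) (𝔼 z, w z * f z)]
    refine expect_congr rfl fun t _ => ?_
    refine (Fintype.expect_equiv (σ t) _ _ fun z => ?_).symm
    rw [hwσ]
  rw [expect_correlation_eq σ hσ, Complex.norm_real, Real.norm_of_nonneg
    (expect_nonneg fun _ _ => by positivity), h1]
  refine (norm_expect_pow_le _ 2).trans (expect_le_expect fun z _ => ?_)
  rw [norm_mul]
  gcongr
  exact mul_le_of_le_one_left (norm_nonneg _) (hw z)

end Averages

/-! ### Box averages along multisets of subgroups -/

section BoxAverages

/-- The multiplicative derivative of `f` in direction `h`. -/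
def mulDeriv {G : Type*} [AddCommGroup G] (h : G) (f : G → ℂ) (x : G) : ℂ :=
  f x * conj (f (x + h))

lemma mulDeriv_comm {G : Type*} [AddCommGroup G] (h k : G) (f : G → ℂ) :
    mulDeriv h (mulDeriv k f) = mulDeriv k (mulDeriv h f) := by
  funext x
  simp only [mulDeriv, map_mul, Complex.conj_conj, add_right_comm x h k]
  ring

lemma norm_mulDeriv_le {G : Type*} [AddCommGroup G] (h : G) {f : G → ℂ} (hf : ∀ x, ‖f x‖ ≤ 1)
    (x : G) : ‖mulDeriv h f x‖ ≤ 1 := by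
  rw [mulDeriv, norm_mul, RCLike.norm_conj]
  exact mul_le_one₀ (hf _) (norm_nonneg _) (hf _)

instance {G : Type*} [AddCommGroup G] :
    LeftCommutative (mulDeriv : G → (G → ℂ) → G → ℂ) := ⟨fun h k f => mulDeriv_comm h k f⟩

/-- The iterated multiplicative derivative of `f` along a multiset of directions. -/
def mulDerivs {G : Type*} [AddCommGroup G] (m : Multiset G) (f : G → ℂ) : G → ℂ :=
  m.foldr mulDeriv f

lemma mulDerivs_cons {G : Type*} [AddCommGroup G] (h : G) (m : Multiset G) (f : G → ℂ) :
    mulDerivs (h ::ₘ m) f = mulDeriv h (mulDerivs m f) := Multiset.foldr_cons ..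

lemma mulDerivs_mulDeriv {G : Type*} [AddCommGroup G] (h : G) (m : Multiset G) (f : G → ℂ) :
    mulDerivs m (mulDeriv h f) = mulDeriv h (mulDerivs m f) := by
  induction m using Multiset.induction_on with
  | empty => rfl
  | cons k m ih => rw [mulDerivs_cons, mulDerivs_cons, ih, mulDeriv_comm]

lemma norm_mulDerivs_le {G : Type*} [AddCommGroup G] (m : Multiset G) {f : G → ℂ}
    (hf : ∀ x, ‖f x‖ ≤ 1) : ∀ x, ‖mulDerivs m f x‖ ≤ 1 := by
  induction m using Multiset.induction_on with
  | empty => exact hf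
  | cons k m ih => rw [mulDerivs_cons]; exact norm_mulDeriv_le k ih

universe u

variable {G : Type u} [AddCommGroup G] [Fintype G]

instance subgroupFintype (H : AddSubgroup G) : Fintype H := Fintype.ofFinite H

/-- Averaging a functional over the multiplicative derivatives along a subgroup. -/
def derivAvg (H : AddSubgroup G) (Φ : (G → ℂ) → ℂ) (f : G → ℂ) : ℂ :=
  𝔼 h : H, Φ (mulDeriv h f)

instance : LeftCommutative (derivAvg : AddSubgroup G → ((G → ℂ) → ℂ) → (G → ℂ) → ℂ) where
  left_comm H K Φ := by
    funext f
    simp only [derivAvg]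
    rw [expect_comm]
    simp_rw [mulDeriv_comm]

/-- The `2 ^ card M`-th power of the box norm along the multiset `M` of subgroups. -/
def boxAvg (M : Multiset (AddSubgroup G)) : (G → ℂ) → ℂ :=
  M.foldr derivAvg fun f => 𝔼 x, f x

lemma boxAvg_zero (f : G → ℂ) : boxAvg 0 f = 𝔼 x, f x := rfl

lemma boxAvg_cons (H : AddSubgroup G) (M : Multiset (AddSubgroup G)) (f : G → ℂ) :
    boxAvg (H ::ₘ M) f = 𝔼 h : H, boxAvg M (mulDeriv h f) := by
  rw [boxAvg, Multiset.foldr_cons]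
  rfl

lemma boxAvg_translate (M : Multiset (AddSubgroup G)) (a : G) :
    ∀ f : G → ℂ, boxAvg M (fun x => f (x + a)) = boxAvg M f := by
  induction M using Multiset.induction_on with
  | empty => exact fun f => Fintype.expect_equiv (Equiv.addRight a) _ _ fun x => rfl
  | cons H M ih =>
    intro f
    simp_rw [boxAvg_cons, ← ih (mulDeriv _ f)]
    refine expect_congr rfl fun h _ => ?_
    congr 1
    funext x
    simp only [mulDeriv, add_right_comm x a]

lemma boxAvg_singleton (H : AddSubgroup G) (f : G → ℂ) :
    boxAvg (H ::ₘ 0) f = ((𝔼 x, ‖𝔼 h : H, f (x + h)‖ ^ 2 : ℝ) : ℂ) := by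
  rw [boxAvg_cons]
  refine expect_correlation_eq (fun h : H => Equiv.addRight (h : G)) (fun t t' z => ?_) f
  simp only [Equiv.coe_addRight, AddSubgroup.coe_add]
  abel

lemma boxAvg_eq_norm {M : Multiset (AddSubgroup G)} (hM : M ≠ 0) :
    ∀ f : G → ℂ, boxAvg M f = (‖boxAvg M f‖ : ℂ) := by
  induction M using Multiset.induction_on with
  | empty => exact absurd rfl hM
  | cons H M ih =>
    intro f
    suffices h : ∃ r : ℝ, 0 ≤ r ∧ boxAvg (H ::ₘ M) f = r by
      obtain ⟨r, hr, h⟩ := h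
      rw [h, Complex.norm_real, Real.norm_of_nonneg hr]
    rcases eq_or_ne M 0 with rfl | h0
    · exact ⟨_, expect_nonneg fun _ _ => by positivity, boxAvg_singleton H f⟩
    · refine ⟨𝔼 h : H, ‖boxAvg M (mulDeriv h f)‖, expect_nonneg fun _ _ => norm_nonneg _, ?_⟩
      rw [boxAvg_cons, ofReal_expect]
      exact expect_congr rfl fun h _ => ih h0 _

lemma norm_expect_boxAvg {α : Type*} [Fintype α] {M : α → Multiset (AddSubgroup G)}
    (hM : ∀ a, M a ≠ 0) (f : α → G → ℂ) :
    ‖𝔼 a, boxAvg (M a) (f a)‖ = 𝔼 a, ‖boxAvg (M a) (f a)‖ := by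
  rw [expect_congr rfl fun a _ => boxAvg_eq_norm (hM a) (f a), ← ofReal_expect,
    Complex.norm_real, Real.norm_of_nonneg (expect_nonneg fun _ _ => norm_nonneg _)]

lemma norm_boxAvg_cons_le (H : AddSubgroup G) (M : Multiset (AddSubgroup G)) (f : G → ℂ) :
    ‖boxAvg (H ::ₘ M) f‖ ≤ 𝔼 h : H, ‖boxAvg M (mulDeriv h f)‖ := by
  rw [boxAvg_cons]
  exact norm_expect_le_expect_norm _

lemma norm_boxAvg_cons (H : AddSubgroup G) {M : Multiset (AddSubgroup G)} (hM : M ≠ 0)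
    (f : G → ℂ) : ‖boxAvg (H ::ₘ M) f‖ = 𝔼 h : H, ‖boxAvg M (mulDeriv h f)‖ := by
  rw [boxAvg_cons, norm_expect_boxAvg fun _ => hM]

lemma norm_boxAvg_le_one (M : Multiset (AddSubgroup G)) :
    ∀ f : G → ℂ, (∀ x, ‖f x‖ ≤ 1) → ‖boxAvg M f‖ ≤ 1 := by
  induction M using Multiset.induction_on with
  | empty => exact fun f hf => norm_expect_le_one f hf
  | cons H M ih =>
    intro f hf
    rw [boxAvg_cons]
    exact norm_expect_le_one _ fun h => ih _ (norm_mulDeriv_le _ hf)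

lemma norm_boxAvg_sq_le (K : AddSubgroup G) (M : Multiset (AddSubgroup G)) :
    ∀ f : G → ℂ, ‖boxAvg M f‖ ^ 2 ≤ ‖boxAvg (K ::ₘ M) f‖ := by
  induction M using Multiset.induction_on with
  | empty =>
    intro f
    have h := norm_expect_sq_le_correlation (fun h : K => Equiv.addRight (h : G))
      (fun t t' z => by simp only [Equiv.coe_addRight, AddSubgroup.coe_add]; abel)
      (fun _ => 1) f (by simp) (by simp)
    rw [boxAvg_cons]
    simpa [boxAvg_zero, mulDeriv] using h
  | cons H M ih =>
    intro f
    rw [Multiset.cons_swap, norm_boxAvg_cons H Multiset.cons_ne_zero, boxAvg_cons]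
    exact (norm_expect_pow_le _ 2).trans (expect_le_expect fun h _ => ih (mulDeriv h f))

/-- A product average over a family of subgroups, computed by averaging one coordinate first. -/
lemma expect_pi_shift {ι : Type*} [Fintype ι] [DecidableEq ι] (H : ι → AddSubgroup G) (i : ι)
    (φ : (∀ i, H i) → ℂ) :
    𝔼 h, φ h = 𝔼 h : (∀ i, H i), 𝔼 t : H i, φ (h + (Pi.single i t : ∀ i, H i)) := by
  rw [expect_comm univ univ fun (h : ∀ i, H i) (t : H i) => φ (h + (Pi.single i t : ∀ i, H i)),
    ← Fintype.expect_const (ι := H i) (𝔼 h, φ h)]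
  exact expect_congr rfl fun t _ =>
    (Fintype.expect_equiv (Equiv.addRight (Pi.single i t : ∀ i, H i)) _ _ fun h => rfl).symm

omit [Fintype G] in
lemma map_add_single {ι : Type*} [DecidableEq ι] (H : ι → AddSubgroup G)
    {s : Finset ι} {i : ι} (hi : i ∉ s) (h : ∀ i, H i) (t : H i) :
    s.val.map (fun j => (((h + Pi.single i t : ∀ i, H i) j : H j) : G)) =
      s.val.map (fun j => (h j : G)) := by
  refine Multiset.map_congr rfl fun j hj => ?_
  have : j ≠ i := by rintro rfl; exact hi hj
  simp [this]

lemma boxAvg_map {ι : Type*} [Fintype ι] [DecidableEq ι] (H : ι → AddSubgroup G) (s : Finset ι) :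
    ∀ f : G → ℂ, boxAvg (s.val.map H) f =
      𝔼 h : ∀ i, H i, 𝔼 x, mulDerivs (s.val.map fun i => (h i : G)) f x := by
  induction s using Finset.induction_on with
  | empty => exact fun f => (Fintype.expect_const _).symm
  | insert i s hi ih =>
    intro f
    simp only [insert_val_of_notMem hi, Multiset.map_cons, boxAvg_cons, ih, mulDerivs_mulDeriv,
      mulDerivs_cons]
    rw [expect_pi_shift H i (fun h => 𝔼 x : G,
      mulDeriv (h i : G) (mulDerivs (s.val.map fun i => (h i : G)) f) x), expect_comm]
    refine expect_congr rfl fun h _ => ?_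
    simp_rw [map_add_single H hi]
    refine Fintype.expect_equiv (Equiv.addLeft (-h i)) _ _ fun t => ?_
    simp

omit [Fintype G] in
/-- The iterated derivative of a bounded function, divided by the function itself, is a product
of bounded weights each of which is invariant under a shear in one of the coordinates. -/
lemma exists_mulDerivs_eq_mul_prod {ι : Type*} [DecidableEq ι]
    (H : ι → AddSubgroup G) (s : Finset ι) {f : G → ℂ} (hf : ∀ x, ‖f x‖ ≤ 1) :
    ∃ w : ι → (∀ i, H i) → G → ℂ, (∀ i h x, ‖w i h x‖ ≤ 1) ∧
      (∀ i h x (t : H i), w i (h + Pi.single i t) (x - t) = w i h x) ∧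
      ∀ h x, mulDerivs (s.val.map fun i => (h i : G)) f x = f x * ∏ i ∈ s, w i h x := by
  induction s using Finset.induction_on with
  | empty => exact ⟨fun _ _ _ => 1, by simp, by simp, fun h x => by simp [mulDerivs]⟩
  | insert i s hi ih =>
    obtain ⟨w, hw1, hw2, hw3⟩ := ih
    refine ⟨Function.update w i fun h x =>
      conj (mulDerivs (s.val.map fun i => (h i : G)) f (x + h i)), ?_, ?_, ?_⟩
    · intro j h x
      rcases eq_or_ne j i with rfl | hj
      · simpa using norm_mulDerivs_le _ hf _
      · simpa [hj] using hw1 j h x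
    · intro j h x t
      rcases eq_or_ne j i with rfl | hj
      · simp only [Function.update_self, map_add_single H hi]
        simp
      · simpa [hj] using hw2 j h x t
    · intro h x
      rw [insert_val_of_notMem hi, Multiset.map_cons, mulDerivs_cons, mulDeriv, prod_insert hi,
        Function.update_self]
      have h1 : ∏ j ∈ s, Function.update w i (fun h x =>
          conj (mulDerivs (s.val.map fun i => (h i : G)) f (x + h i))) j h x =
          ∏ j ∈ s, w j h x := by
        refine prod_congr rfl fun j hj => ?_
        rw [Function.update_of_ne]
        rintro rfl
        exact hi hj
      rw [h1, hw3 h x]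
      ring

/-- A Gowers-Cauchy-Schwarz inequality: weights which are invariant under shears in one coordinate
are eliminated from a parametrised average. -/
lemma norm_expect_mul_prod_pow_le {ι : Type*} [Fintype ι] [DecidableEq ι] (H : ι → AddSubgroup G)
    (s : Finset ι) : ∀ {Y : Type u} [Fintype Y] [Nonempty Y] (F : Y → G → ℂ)
      (w : ι → Y → (∀ i, H i) → G → ℂ), (∀ i y h x, ‖w i y h x‖ ≤ 1) →
      (∀ i y h x (t : H i), w i y (h + Pi.single i t) (x - t) = w i y h x) →
      ‖𝔼 y, 𝔼 h, 𝔼 x, F y x * ∏ i ∈ s, w i y h x‖ ^ 2 ^ #s ≤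
        ‖𝔼 y, boxAvg (s.val.map H) (F y)‖ := by
  induction s using Finset.induction_on with
  | empty =>
    intro Y _ _ F w _ _
    simp [boxAvg_zero]
  | insert i s hi ih =>
    intro Y _ _ F w hw hinv
    have key := norm_expect_sq_le_correlation (α := Y × (∀ i, H i) × G)
      (fun t : H i => (Equiv.refl Y).prodCongr
        ((Equiv.addRight (Pi.single i t : ∀ i, H i)).prodCongr (Equiv.subRight (t : G))))
      (fun t t' z => by
        ext
        · simp
        · simp [Pi.single_add, add_assoc, add_comm]
        · simp; abel)
      (fun z => w i z.1 z.2.1 z.2.2)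
      (fun z => F z.1 z.2.2 * ∏ j ∈ s, w j z.1 z.2.1 z.2.2)
      (fun z => hw _ _ _ _) (fun t z => hinv i z.1 z.2.1 z.2.2 t)
    have step := ih (Y := H i × Y) (fun p => mulDeriv (-(p.1 : G)) (F p.2))
      (fun j p h x => w j p.2 h x *
        conj (w j p.2 (h + (Pi.single i p.1 : ∀ i, H i)) (x - p.1)))
      (fun j p h x => by
        rw [norm_mul, RCLike.norm_conj]
        exact mul_le_one₀ (hw _ _ _ _) (norm_nonneg _) (hw _ _ _ _))
      (fun j p h x t => by
        rw [hinv, add_right_comm, sub_right_comm, hinv])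
    rw [card_insert_of_notMem hi, pow_succ', pow_mul]
    have h1 : 𝔼 y, 𝔼 h, 𝔼 x, F y x * ∏ j ∈ insert i s, w j y h x =
        𝔼 z : Y × (∀ i, H i) × G, w i z.1 z.2.1 z.2.2 *
          (F z.1 z.2.2 * ∏ j ∈ s, w j z.1 z.2.1 z.2.2) := by
      simp only [expect_prod, prod_insert hi, mul_left_comm]
    have h2 : 𝔼 t : H i, 𝔼 z : Y × (∀ i, H i) × G,
        (F z.1 z.2.2 * ∏ j ∈ s, w j z.1 z.2.1 z.2.2) *
          conj (F z.1 (z.2.2 - t) *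
            ∏ j ∈ s, w j z.1 (z.2.1 + (Pi.single i t : ∀ i, H i)) (z.2.2 - t)) =
        𝔼 p : H i × Y, 𝔼 h, 𝔼 x, mulDeriv (-(p.1 : G)) (F p.2) x * ∏ j ∈ s, (w j p.2 h x *
        conj (w j p.2 (h + (Pi.single i p.1 : ∀ i, H i)) (x - p.1))) := by
      simp only [expect_prod, mulDeriv, prod_mul_distrib, map_mul, map_prod, ← sub_eq_add_neg,
        mul_mul_mul_comm]
    have h3 : 𝔼 p : H i × Y, boxAvg (s.val.map H) (mulDeriv (-(p.1 : G)) (F p.2)) =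
        𝔼 y, boxAvg ((insert i s).val.map H) (F y) := by
      simp only [expect_prod, insert_val_of_notMem hi, Multiset.map_cons, boxAvg_cons]
      rw [expect_comm]
      refine expect_congr rfl fun y _ => ?_
      exact Fintype.expect_equiv (Equiv.neg (H i)) _ _ fun t => by simp
    rw [h1, ← h3]
    refine (pow_le_pow_left₀ (by positivity) ?_ _).trans step
    rw [← h2]
    exact key

lemma expect_sub_eq_expect_sup (L L' : AddSubgroup G) (φ : G → ℂ) :
    𝔼 p : L × L', φ (p.1 - p.2) = 𝔼 d : ↥(L ⊔ L'), φ d := by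
  have h1 : ∀ d : ↥(L ⊔ L'), 𝔼 p : L × L', φ (p.1 - p.2) = 𝔼 p : L × L', φ (d + (p.1 - p.2)) := by
    rintro ⟨d, hd⟩
    obtain ⟨a, ha, b, hb, rfl⟩ := AddSubgroup.mem_sup.1 hd
    refine (Fintype.expect_equiv ((Equiv.addLeft (⟨a, ha⟩ : L)).prodCongr
      (Equiv.addLeft (-⟨b, hb⟩ : L'))) _ _ fun p => ?_).symm
    simp only [Equiv.prodCongr_apply, Prod.map, Equiv.coe_addLeft, AddSubgroup.coe_add,
      AddSubgroup.coe_neg]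
    congr 1
    abel
  have h2 : ∀ p : L × L', 𝔼 d : ↥(L ⊔ L'), φ (d + (p.1 - p.2)) = 𝔼 d : ↥(L ⊔ L'), φ d := by
    intro p
    exact Fintype.expect_equiv (Equiv.addRight (⟨p.1 - p.2,
      sub_mem (AddSubgroup.mem_sup_left p.1.2) (AddSubgroup.mem_sup_right p.2.2)⟩ :
        ↥(L ⊔ L'))) _ _ fun d => rfl
  rw [← Fintype.expect_const (ι := ↥(L ⊔ L')) (𝔼 p : L × L', φ (p.1 - p.2)),
    ← Fintype.expect_const (ι := L × L') (𝔼 d : ↥(L ⊔ L'), φ d),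
    expect_congr rfl fun d _ => h1 d, expect_comm]
  exact expect_congr rfl fun p _ => h2 p

lemma add_single_inl {ι ι' : Type*} [DecidableEq ι] [DecidableEq ι'] {A : ι ⊕ ι' → Type*}
    [∀ k, AddMonoid (A k)] (h : ∀ k, A k) (i : ι) (t : A (Sum.inl i)) :
    (fun j => (h + Pi.single (Sum.inl i) t : ∀ k, A k) (Sum.inl j)) =
      (fun j => h (Sum.inl j)) + (Pi.single i t : ∀ j, A (Sum.inl j)) := by
  funext j
  rcases eq_or_ne j i with rfl | hj <;> simp [*]

lemma add_single_inr {ι ι' : Type*} [DecidableEq ι] [DecidableEq ι'] {A : ι ⊕ ι' → Type*}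
    [∀ k, AddMonoid (A k)] (h : ∀ k, A k) (i : ι') (t : A (Sum.inr i)) :
    (fun j => (h + Pi.single (Sum.inr i) t : ∀ k, A k) (Sum.inr j)) =
      (fun j => h (Sum.inr j)) + (Pi.single i t : ∀ j, A (Sum.inr j)) := by
  funext j
  rcases eq_or_ne j i with rfl | hj <;> simp [*]

/-- The correlation of two generalised dual functions of `f` is controlled by a box average of `f`
in which the first subgroups of the two families are concatenated. -/
lemma norm_expect_dual_mul_conj_dual_pow_le {m m' : ℕ} (L L' : AddSubgroup G)
    (H : Fin m → AddSubgroup G) (H' : Fin m' → AddSubgroup G) (f : G → ℂ)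
    (w : Fin m → L → (∀ i, H i) → G → ℂ) (w' : Fin m' → L' → (∀ i, H' i) → G → ℂ)
    (hw : ∀ i l h x, ‖w i l h x‖ ≤ 1) (hw' : ∀ i l h x, ‖w' i l h x‖ ≤ 1)
    (hinv : ∀ i l h x (t : H i), w i l (h + Pi.single i t) (x - t) = w i l h x)
    (hinv' : ∀ i l h x (t : H' i), w' i l (h + Pi.single i t) (x - t) = w' i l h x) :
    ‖𝔼 x, (𝔼 l : L, 𝔼 h, conj (f (x + l)) * ∏ i, w i l h x) *
      conj (𝔼 l : L', 𝔼 h, conj (f (x + l)) * ∏ i, w' i l h x)‖ ^ 2 ^ (m + m') ≤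
      ‖boxAvg ((L ⊔ L') ::ₘ (univ.val.map H + univ.val.map H')) f‖ := by
  have key := norm_expect_mul_prod_pow_le (Sum.elim H H') univ
    (Y := L × L') (fun p x => conj (f (x + p.1)) * f (x + p.2))
    (fun k p h x => Sum.rec (motive := fun _ => ℂ) (fun i => w i p.1 (fun j => h (Sum.inl j)) x)
      (fun i => conj (w' i p.2 (fun j => h (Sum.inr j)) x)) k)
    (by
      rintro (i | i) p h x
      · exact hw _ _ _ _
      · simpa using hw' _ _ _ _)
    (by
      rintro (i | i) p h x t
      · exact (congrArg (fun k => w i p.1 k (x - t)) (add_single_inl h i t)).trans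
          (hinv i p.1 (fun j => h (Sum.inl j)) x t)
      · exact congrArg conj ((congrArg (fun k => w' i p.2 k (x - t)) (add_single_inr h i t)).trans
          (hinv' i p.2 (fun j => h (Sum.inr j)) x t)))
  have hcard : #(univ : Finset (Fin m ⊕ Fin m')) = m + m' := by simp
  have hmap : (univ : Finset (Fin m ⊕ Fin m')).val.map (Sum.elim H H') =
      univ.val.map H + univ.val.map H' := by
    simp [← univ_disjSum_univ, Multiset.disjSum]
  rw [hcard, hmap] at key
  refine le_of_eq_of_le ?_ (key.trans_eq ?_)
  · congr 2
    simp only [conj_expect, Fintype.expect_mul_expect, expect_prod]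
    rw [expect_comm]
    refine expect_congr rfl fun l _ => ?_
    rw [expect_comm]
    refine expect_congr rfl fun l' _ => ?_
    rw [expect_comm]
    simp only [expect_comm (univ : Finset G)]
    rw [← expect_prod (fun q : (∀ i, H i) × (∀ i, H' i) => 𝔼 x : G,
      conj (f (x + l)) * (∏ i, w i l q.1 x) * conj (conj (f (x + l')) * ∏ i, w' i l' q.2 x))]
    refine (Fintype.expect_equiv (Equiv.sumPiEquivProdPi fun k => ↥(Sum.elim H H' k)) _ _
      fun h => expect_congr rfl fun x _ => ?_).symm
    rw [Fintype.prod_sum_type, map_mul, Complex.conj_conj, map_prod]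
    exact mul_mul_mul_comm _ _ _ _
  · rw [boxAvg_cons, ← expect_sub_eq_expect_sup L L' fun d => boxAvg _ (mulDeriv d f)]
    congr 1
    refine expect_congr rfl fun p _ => ?_
    rw [← boxAvg_translate _ (p.2 : G) (mulDeriv _ f)]
    congr 1
    funext x
    rw [mulDeriv, mul_comm]
    congr 3
    abel

lemma exists_map_univ_eq {α : Type*} (M : Multiset α) {m : ℕ} (hM : M.card = m) :
    ∃ H : Fin m → α, M = univ.val.map H := by
  induction M using Quotient.inductionOn with
  | h l =>
    subst hM
    refine ⟨fun i => l.get i, ?_⟩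
    rw [Fin.univ_val_map]
    exact congrArg _ (List.ofFn_get l).symm

/-- One subgroup in each family of an averaged box norm is concatenated. -/
lemma expect_norm_boxAvg_cons_pow_le {I : Type*} [Fintype I] [Nonempty I]
    (L : I → AddSubgroup G) (M : I → Multiset (AddSubgroup G)) {m : ℕ} (hM : ∀ i, (M i).card = m)
    {f : G → ℂ} (hf : ∀ x, ‖f x‖ ≤ 1) :
    (𝔼 i, ‖boxAvg (L i ::ₘ M i) f‖) ^ (2 * 2 ^ (m + m)) ≤
      𝔼 i, 𝔼 j, ‖boxAvg ((L i ⊔ L j) ::ₘ (M i + M j)) f‖ := by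
  choose H hH using fun i => exists_map_univ_eq (M i) (hM i)
  choose w hw1 hw2 hw3 using fun (i : I) (l : L i) =>
    exists_mulDerivs_eq_mul_prod (H i) univ (norm_mulDeriv_le (l : G) hf)
  set D : I → G → ℂ := fun i x => 𝔼 l : L i, 𝔼 h, conj (f (x + l)) * ∏ k, w i l k h x with hD
  have h1 : ∀ i, boxAvg (L i ::ₘ M i) f = 𝔼 x, f x * D i x := by
    intro i
    simp only [boxAvg_cons, hH i, boxAvg_map, hw3, hD, mul_expect]
    rw [expect_comm univ (univ : Finset (L i))]
    refine expect_congr rfl fun l _ => ?_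
    rw [expect_comm]
    simp only [mulDeriv, mul_assoc]
  have h2 : (𝔼 i, ‖boxAvg (L i ::ₘ M i) f‖) ^ 2 ≤
      ‖𝔼 p : I × I, 𝔼 x, D p.1 x * conj (D p.2 x)‖ := by
    rw [← norm_expect_boxAvg (fun _ => Multiset.cons_ne_zero) (fun _ => f)]
    have e1 : 𝔼 i, boxAvg (L i ::ₘ M i) f = 𝔼 x, f x * 𝔼 i, D i x := by
      simp only [h1, mul_expect]
      rw [expect_comm]
    have e2 : 𝔼 p : I × I, 𝔼 x, D p.1 x * conj (D p.2 x) =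
        ((𝔼 x, ‖𝔼 i, D i x‖ ^ 2 : ℝ) : ℂ) := by
      rw [ofReal_expect, expect_comm]
      refine expect_congr rfl fun x _ => ?_
      rw [← Complex.normSq_eq_norm_sq, ← Complex.mul_conj, conj_expect, Fintype.expect_mul_expect,
        expect_prod]
    rw [e1, e2, Complex.norm_real, Real.norm_of_nonneg (expect_nonneg fun _ _ => by positivity)]
    refine (norm_expect_pow_le _ 2).trans (expect_le_expect fun x _ => ?_)
    rw [norm_mul]
    gcongr
    exact mul_le_of_le_one_left (norm_nonneg _) (hf x)
  rw [pow_mul, ← expect_prod fun p : I × I => ‖boxAvg ((L p.1 ⊔ L p.2) ::ₘ (M p.1 + M p.2)) f‖]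
  refine (pow_le_pow_left₀ (by positivity) h2 _).trans
    ((norm_expect_pow_le _ _).trans (expect_le_expect fun p _ => ?_))
  rw [hH p.1, hH p.2]
  exact norm_expect_dual_mul_conj_dual_pow_le (L p.1) (L p.2) (H p.1) (H p.2) f
    (fun k l => w p.1 l k) (fun k l => w p.2 l k) (fun k l => hw1 p.1 l k)
    (fun k l => hw1 p.2 l k) (fun k l => hw2 p.1 l k) (fun k l => hw2 p.2 l k)

lemma expect_norm_boxAvg_add_cons_pow_le {I : Type*} [Fintype I] [Nonempty I]
    (L : I → AddSubgroup G) (M : I → Multiset (AddSubgroup G)) {m : ℕ} (hM : ∀ i, (M i).card = m)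
    (A : Multiset (AddSubgroup G)) : ∀ {f : G → ℂ}, (∀ x, ‖f x‖ ≤ 1) →
    (𝔼 i, ‖boxAvg (A + L i ::ₘ M i) f‖) ^ (2 * 2 ^ (m + m)) ≤
      𝔼 i, 𝔼 j, ‖boxAvg (A + (L i ⊔ L j) ::ₘ (M i + M j)) f‖ := by
  induction A using Multiset.induction_on with
  | empty =>
    intro f hf
    simpa using expect_norm_boxAvg_cons_pow_le L M hM hf
  | cons K A ih =>
    intro f hf
    have h1 : 𝔼 i, ‖boxAvg (K ::ₘ A + L i ::ₘ M i) f‖ ≤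
        𝔼 h : K, 𝔼 i, ‖boxAvg (A + L i ::ₘ M i) (mulDeriv h f)‖ := by
      rw [expect_comm]
      refine expect_le_expect fun i _ => ?_
      rw [Multiset.cons_add]
      exact norm_boxAvg_cons_le _ _ _
    have h2 : 𝔼 i, 𝔼 j, ‖boxAvg (K ::ₘ A + (L i ⊔ L j) ::ₘ (M i + M j)) f‖ =
        𝔼 h : K, 𝔼 i, 𝔼 j, ‖boxAvg (A + (L i ⊔ L j) ::ₘ (M i + M j)) (mulDeriv h f)‖ := by
      have hne : ∀ i j, A + (L i ⊔ L j) ::ₘ (M i + M j) ≠ 0 := fun i j => by simp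
      simp only [Multiset.cons_add, norm_boxAvg_cons _ (hne _ _)]
      conv_rhs => rw [expect_comm]
      refine expect_congr rfl fun i _ => ?_
      exact expect_comm _ _ _
    rw [h2]
    refine (pow_le_pow_left₀ (expect_nonneg fun _ _ => norm_nonneg _) h1 _).trans
      ((expect_pow_le_expect_pow _
        (fun _ => expect_nonneg fun _ _ => norm_nonneg _) _).trans
      (expect_le_expect fun h _ => ih (norm_mulDeriv_le _ hf)))


/-- A version of `expect_norm_boxAvg_add_cons_pow_le` whose right-hand side is symmetric. -/
lemma expect_norm_boxAvg_add_cons_pow_le_symm {I : Type*} [Fintype I] [Nonempty I]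
    (L : I → AddSubgroup G) (M : I → Multiset (AddSubgroup G)) {m : ℕ} (hM : ∀ i, (M i).card = m)
    (A : Multiset (AddSubgroup G)) {f : G → ℂ} (hf : ∀ x, ‖f x‖ ≤ 1) :
    (𝔼 i, ‖boxAvg (A + L i ::ₘ M i) f‖) ^ (2 * 2 ^ (m + m) * 2) ≤
      𝔼 i, 𝔼 j, ‖boxAvg (A + ({L i ⊔ L j} + {L j ⊔ L i} + (M i + M j))) f‖ := by
  have key := expect_norm_boxAvg_add_cons_pow_le L M hM A hf
  rw [← expect_prod
    fun p : I × I => ‖boxAvg (A + (L p.1 ⊔ L p.2) ::ₘ (M p.1 + M p.2)) f‖] at key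
  rw [pow_mul, ← expect_prod fun p : I × I =>
    ‖boxAvg (A + ({L p.1 ⊔ L p.2} + {L p.2 ⊔ L p.1} + (M p.1 + M p.2))) f‖]
  refine (pow_le_pow_left₀ (pow_nonneg (expect_nonneg fun _ _ => norm_nonneg _) _) key 2).trans
    ((expect_pow_le_expect_pow _ (fun _ => norm_nonneg _) 2).trans
      (expect_le_expect fun p _ => (norm_boxAvg_sq_le (L p.2 ⊔ L p.1) _ f).trans_eq ?_))
  congr 2
  simp only [← Multiset.singleton_add]
  abel

/-! ### The concatenation scheme -/

lemma goodPair_castSucc_iff {s : ℕ} (j : Fin s) (b b' : Bool) (e e' : Fin s → Bool) :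
    goodPair (s + 1) j.castSucc (Fin.cons b e) (Fin.cons b' e') ↔
      b = b' ∧ goodPair s j e e' := by
  have hj := j.isLt
  simp only [goodPair, Fin.forall_fin_succ, Fin.cons_zero, Fin.cons_succ, Fin.val_zero,
    Fin.val_succ, Fin.val_castSucc]
  constructor
  · rintro ⟨⟨h0, h1⟩, -, h2⟩
    exact ⟨h0 (by omega), fun k hk => h1 k (by omega), fun k hk => h2 k (by omega)⟩
  · rintro ⟨h0, h1, h2⟩
    exact ⟨⟨fun _ => h0, fun k hk => h1 k (by omega)⟩, fun h => by omega,
      fun k hk => h2 k (by omega)⟩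

lemma goodPair_last_iff {s : ℕ} (b b' : Bool) (e e' : Fin s → Bool) :
    goodPair (s + 1) (Fin.last s) (Fin.cons b e) (Fin.cons b' e') ↔ b ≠ b' := by
  simp only [goodPair, Fin.forall_fin_succ, Fin.cons_zero, Fin.cons_succ, Fin.val_zero,
    Fin.val_succ, Fin.val_last]
  constructor
  · rintro ⟨-, h, -⟩
    exact h (by omega)
  · exact fun h => ⟨⟨fun _ => by omega, fun k hk => by omega⟩, fun _ => h,
      fun k hk => by omega⟩

lemma sum_bool_pi_succ {M : Type*} [AddCommMonoid M] {s : ℕ} (g : (Fin (s + 1) → Bool) → M) :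
    ∑ ε, g ε = ∑ e : Fin s → Bool, (g (Fin.cons false e) + g (Fin.cons true e)) := by
  rw [← (Fin.consEquiv fun _ : Fin (s + 1) => Bool).sum_comp, Fintype.sum_prod_type_right]
  refine sum_congr rfl fun e _ => ?_
  rw [Fintype.sum_bool, add_comm]
  rfl

open Classical in
/-- The multiset of all the pairwise sums of subgroups which are obtained by concatenation. -/
def pairSubgroups {G I : Type*} [AddCommGroup G] (s : ℕ) (H : I → Fin s → AddSubgroup G)
    (ii : (Fin s → Bool) → I) : Multiset (AddSubgroup G) :=
  ∑ j, ∑ ε, ∑ ε', if goodPair s j ε ε' then {H (ii ε) j ⊔ H (ii ε') j} else 0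

lemma pairSubgroups_succ {G I : Type*} [AddCommGroup G] {s : ℕ}
    (H : I → Fin (s + 1) → AddSubgroup G) (ii : (Fin (s + 1) → Bool) → I) :
    pairSubgroups (s + 1) H ii =
      pairSubgroups s (fun i j => H i j.castSucc) (fun e => ii (Fin.cons false e)) +
      pairSubgroups s (fun i j => H i j.castSucc) (fun e => ii (Fin.cons true e)) +
      ∑ e' : Fin s → Bool, ∑ e : Fin s → Bool,
        ({H (ii (Fin.cons false e)) (Fin.last s) ⊔ H (ii (Fin.cons true e')) (Fin.last s)} +
        {H (ii (Fin.cons true e')) (Fin.last s) ⊔ H (ii (Fin.cons false e)) (Fin.last s)}) := by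
  classical
  have hc (j : Fin s) (b b' : Bool) (e e' : Fin s → Bool) (x : Multiset (AddSubgroup G)) :
      (if goodPair (s + 1) j.castSucc (Fin.cons b e) (Fin.cons b' e') then x else 0) =
        if b = b' then if goodPair s j e e' then x else 0 else 0 := by
    simp only [goodPair_castSucc_iff, ite_and]
  simp only [pairSubgroups, Fin.sum_univ_castSucc, sum_bool_pi_succ, hc,
    goodPair_last_iff, sum_add_distrib]
  simp only [ne_eq, not_true_eq_false, not_false_eq_true, if_true, if_false,
    sum_const_zero, add_zero, zero_add, Bool.false_eq_true, Bool.true_eq_false]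
  rw [sum_comm (f := fun e' e : Fin s → Bool => ({H (ii (Fin.cons false e)) (Fin.last s) ⊔
    H (ii (Fin.cons true e')) (Fin.last s)} : Multiset (AddSubgroup G)))]
  abel

/-- Gluing two families indexed by a cube to one indexed by the cube of one dimension more. -/
def glueEquiv (s : ℕ) (I : Type*) :
    ((Fin s → Bool) → I) × ((Fin s → Bool) → I) ≃ ((Fin (s + 1) → Bool) → I) where
  toFun p ε := bif ε 0 then p.2 (Fin.tail ε) else p.1 (Fin.tail ε)
  invFun ii := (fun e => ii (Fin.cons false e), fun e => ii (Fin.cons true e))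
  left_inv p := rfl
  right_inv ii := by
    funext ε
    have hε : Fin.cons (ε 0) (Fin.tail ε) = ε := Fin.cons_self_tail ε
    cases h : ε 0 <;> simp only [h] at hε ⊢ <;> simp [hε]

/-- The exponent in the concatenation inequality. -/
def concatExp : ℕ → ℕ → ℕ
  | 0, _ => 1
  | s + 1, n =>
    2 * 2 ^ (s + n + (s + n)) * 2 * concatExp s (n + 2) * concatExp s (n + 2 ^ s * 2)

lemma concatExp_pos (s : ℕ) : ∀ n, 0 < concatExp s n := by
  induction s with
  | zero => exact fun _ => Nat.one_pos
  | succ s ih =>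
    intro n
    have h1 := ih (n + 2)
    have h2 := ih (n + 2 ^ s * 2)
    rw [concatExp]
    positivity

lemma expect_norm_boxAvg_pow_concatExp_le {I : Type*} [Fintype I] [Nonempty I] (s : ℕ) :
    ∀ (n : ℕ) (H : I → Fin s → AddSubgroup G) (K : I → Multiset (AddSubgroup G))
      (_ : ∀ i, (K i).card = n) (A : Multiset (AddSubgroup G)) {f : G → ℂ} (_ : ∀ x, ‖f x‖ ≤ 1),
      (𝔼 i, ‖boxAvg (A + (∑ j, {H i j} + K i)) f‖) ^ concatExp s n ≤
        𝔼 ii : (Fin s → Bool) → I, ‖boxAvg (A + (pairSubgroups s H ii + ∑ ε, K (ii ε))) f‖ := by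
  induction s with
  | zero =>
    intro n H K hK A f hf
    rw [concatExp, pow_one]
    refine le_of_eq (Fintype.expect_equiv (Equiv.funUnique (Fin 0 → Bool) I).symm _ _ fun i => ?_)
    simp [pairSubgroups]
  | succ s ih =>
    intro n H K hK A f hf
    set H' : I → Fin s → AddSubgroup G := fun i j => H i j.castSucc with hH'
    set L : I → AddSubgroup G := fun i => H i (Fin.last s) with hL
    set M : I → Multiset (AddSubgroup G) := fun i => ∑ j, {H' i j} + K i with hM
    set R : I → I → Multiset (AddSubgroup G) := fun i j => {L i ⊔ L j} + {L j ⊔ L i} with hR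
    have hMcard : ∀ i, (M i).card = s + n := fun i => by simp [hM, hK]
    have hconcat : (𝔼 i, ‖boxAvg (A + (∑ j, {H i j} + K i)) f‖) ^
        (2 * 2 ^ (s + n + (s + n)) * 2) ≤
        𝔼 j, 𝔼 i, ‖boxAvg (A + M j + (∑ k, {H' i k} + (K i + R i j))) f‖ := by
      refine le_of_eq_of_le ?_
        ((expect_norm_boxAvg_add_cons_pow_le_symm L M hMcard A hf).trans_eq ?_)
      · congr 1
        refine expect_congr rfl fun i _ => ?_
        rw [Fin.sum_univ_castSucc, ← Multiset.singleton_add]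
        congr 2
        simp only [hM, hL, hH']
        abel
      · rw [expect_comm]
        refine expect_congr rfl fun j _ => expect_congr rfl fun i _ => ?_
        congr 2
        simp only [hM, hR]
        abel
    have hleft : (𝔼 j, 𝔼 i, ‖boxAvg (A + M j + (∑ k, {H' i k} + (K i + R i j))) f‖) ^
        concatExp s (n + 2) ≤ 𝔼 ii : (Fin s → Bool) → I, 𝔼 j,
          ‖boxAvg (A + (pairSubgroups s H' ii + ∑ ε, K (ii ε)) +
            (∑ k, {H' j k} + (K j + ∑ ε, R (ii ε) j))) f‖ := by
      refine (expect_pow_le_expect_pow _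
        (fun _ => expect_nonneg fun _ _ => norm_nonneg _) _).trans ?_
      refine (expect_le_expect fun j _ => ih (n + 2) H' (fun i => K i + R i j)
        (fun i => by simp [hK, hR]) (A + M j) hf).trans_eq ?_
      rw [expect_comm]
      refine expect_congr rfl fun ii _ => expect_congr rfl fun j _ => ?_
      congr 2
      simp only [hM, sum_add_distrib]
      abel
    have hright : (𝔼 ii : (Fin s → Bool) → I, 𝔼 j,
          ‖boxAvg (A + (pairSubgroups s H' ii + ∑ ε, K (ii ε)) +
            (∑ k, {H' j k} + (K j + ∑ ε, R (ii ε) j))) f‖) ^ concatExp s (n + 2 ^ s * 2) ≤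
        𝔼 ii : (Fin (s + 1) → Bool) → I,
          ‖boxAvg (A + (pairSubgroups (s + 1) H ii + ∑ ε, K (ii ε))) f‖ := by
      refine (expect_pow_le_expect_pow _
        (fun _ => expect_nonneg fun _ _ => norm_nonneg _) _).trans ?_
      refine (expect_le_expect fun ii _ => ih (n + 2 ^ s * 2) H'
        (fun j => K j + ∑ ε, R (ii ε) j) (fun i => by simp [hK, hR])
        (A + (pairSubgroups s H' ii + ∑ ε, K (ii ε))) hf).trans_eq ?_
      rw [← expect_prod fun p : ((Fin s → Bool) → I) × ((Fin s → Bool) → I) =>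
        ‖boxAvg (A + (pairSubgroups s H' p.1 + ∑ ε, K (p.1 ε)) + (pairSubgroups s H' p.2 +
          ∑ ε, (K (p.2 ε) + ∑ ε', R (p.1 ε') (p.2 ε)))) f‖]
      refine Fintype.expect_equiv (glueEquiv s I) _ _ fun p => ?_
      congr 2
      have h0 : ∀ e, glueEquiv s I p (Fin.cons false e) = p.1 e := fun e => rfl
      have h1 : ∀ e, glueEquiv s I p (Fin.cons true e) = p.2 e := fun e => rfl
      rw [pairSubgroups_succ, sum_bool_pi_succ]
      simp only [h0, h1, hR, hL, hH', sum_add_distrib]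
      abel
    rw [concatExp, pow_mul, pow_mul]
    have hnn : 0 ≤ 𝔼 i, ‖boxAvg (A + (∑ j, {H i j} + K i)) f‖ :=
      expect_nonneg fun _ _ => norm_nonneg _
    exact (pow_le_pow_left₀ (by positivity) ((pow_le_pow_left₀ (by positivity) hconcat _).trans
      hleft) _).trans hright

/-! ### Box norms as box averages -/

omit [Fintype G] in
lemma mulDerivs_map_eq_prod {ι : Type*} [DecidableEq ι] (h : ι → G) (s : Finset ι) (f : G → ℂ) :
    ∀ x, mulDerivs (s.val.map h) f x =
      ∏ t ∈ s.powerset, conjIter #t (f (x + ∑ i ∈ t, h i)) := by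
  induction s using Finset.induction_on with
  | empty => simp [mulDerivs, conjIter]
  | insert i s hi ih =>
    intro x
    rw [insert_val_of_notMem hi, Multiset.map_cons, mulDerivs_cons, mulDeriv, ih, ih,
      prod_powerset_insert hi, map_prod]
    congr 1
    refine prod_congr rfl fun t ht => ?_
    have hit : i ∉ t := fun h => hi (mem_powerset.1 ht h)
    rw [card_insert_of_notMem hit, sum_insert hit, ← add_assoc, conjIter, conjIter]
    by_cases hc : Even #t <;> simp [hc, Nat.even_add_one]

lemma boxNorm_eq_boxAvg {ι : Type*} [Fintype ι] (H : ι → AddSubgroup G) (f : G → ℂ) :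
    boxNorm H f = (boxAvg (univ.val.map H) f).re ^ ((1 : ℝ) / 2 ^ Fintype.card ι) := by
  classical
  rw [boxNorm, Nat.card_eq_fintype_card, boxAvg_map, expect_comm]
  congr 2
  rw [eavg_eq_expect]
  refine expect_congr rfl fun x _ => ?_
  rw [eavg_eq_expect]
  refine expect_congr rfl fun h _ => ?_
  let : Fintype (ι → Bool) := Fintype.ofFinite _
  rw [mulDerivs_map_eq_prod, powerset_univ]
  refine prod_bij (fun ε _ => univ.filter fun i => ε i = true) (fun _ _ => mem_univ _) ?_ ?_ ?_
  · intro ε _ ε' _ heq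
    funext i
    have := congrArg (i ∈ ·) heq
    simpa using this
  · intro t _
    exact ⟨fun i => decide (i ∈ t), mem_univ _, by ext; simp⟩
  · intro ε _
    rw [sum_filter, card_filter, epsWt]
    congr!

lemma pairSubgroups_eq_map {G I : Type*} [AddCommGroup G] (s : ℕ) (H : I → Fin s → AddSubgroup G)
    (ii : (Fin s → Bool) → I)
    [Fintype {q : Fin s × ((Fin s → Bool) × (Fin s → Bool)) // goodPair s q.1 q.2.1 q.2.2}] :
    (univ : Finset {q : Fin s × ((Fin s → Bool) × (Fin s → Bool)) //
        goodPair s q.1 q.2.1 q.2.2}).val.map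
      (fun q => H (ii q.1.2.1) q.1.1 ⊔ H (ii q.1.2.2) q.1.1) = pairSubgroups s H ii := by
  classical
  rw [pairSubgroups, ← Multiset.sum_map_singleton (Multiset.map _ _), Multiset.map_map]
  change ∑ q : {q : Fin s × ((Fin s → Bool) × (Fin s → Bool)) // goodPair s q.1 q.2.1 q.2.2},
    ({H (ii q.1.2.1) q.1.1 ⊔ H (ii q.1.2.2) q.1.1} : Multiset (AddSubgroup G)) = _
  have h1 := sum_subtype (F := inferInstance)
    (p := fun q : Fin s × ((Fin s → Bool) × (Fin s → Bool)) => goodPair s q.1 q.2.1 q.2.2)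
    (univ.filter fun q => goodPair s q.1 q.2.1 q.2.2)
    (fun q => by simp)
    (fun q => ({H (ii q.2.1) q.1 ⊔ H (ii q.2.2) q.1} : Multiset (AddSubgroup G)))
  rw [← h1, sum_filter]
  simp only [Fintype.sum_prod_type]

end BoxAverages

/-- Proposition 2.5, concatenation of box norms, version I. -/
theorem statement5 (s : ℕ) :
    ∃ t : ℕ, 0 < t ∧
      ∀ (G : Type*) [AddCommGroup G] [Finite G] (I : Type*) [Finite I] [Nonempty I]
        (H : I → Fin s → AddSubgroup G) (f : G → ℂ), (∀ x, ‖f x‖ ≤ 1) →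
        (eavgR fun i : I => boxNorm (H i) f ^ 2 ^ s) ^ t ≤
          eavgR fun ii : (Fin s → Bool) → I =>
            boxNorm
              (fun q : {q : Fin s × ((Fin s → Bool) × (Fin s → Bool)) //
                  goodPair s q.1 q.2.1 q.2.2} =>
                H (ii q.1.2.1) q.1.1 ⊔ H (ii q.1.2.2) q.1.1) f := by
  refine ⟨concatExp s 0, concatExp_pos s 0, fun G _ _ I _ _ H f hf => ?_⟩
  have := Fintype.ofFinite G
  have := Fintype.ofFinite I
  have hR : ∀ ii : (Fin s → Bool) → I,
      boxNorm (fun q : {q : Fin s × ((Fin s → Bool) × (Fin s → Bool)) //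
          goodPair s q.1 q.2.1 q.2.2} => H (ii q.1.2.1) q.1.1 ⊔ H (ii q.1.2.2) q.1.1) f =
        (boxAvg (pairSubgroups s H ii) f).re ^ ((1 : ℝ) / 2 ^ Nat.card
          {q : Fin s × ((Fin s → Bool) × (Fin s → Bool)) // goodPair s q.1 q.2.1 q.2.2}) := by
    intro ii
    have := Fintype.ofFinite
      {q : Fin s × ((Fin s → Bool) × (Fin s → Bool)) // goodPair s q.1 q.2.1 q.2.2}
    rw [boxNorm_eq_boxAvg, pairSubgroups_eq_map, Nat.card_eq_fintype_card]
  simp only [eavgR_eq_expect, boxNorm_eq_boxAvg (H _), hR, Fintype.card_fin]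
  cases s with
  | zero => simp [concatExp, pairSubgroups, boxAvg_zero]
  | succ s =>
    have hre : ∀ {M : Multiset (AddSubgroup G)}, M ≠ 0 → (boxAvg M f).re = ‖boxAvg M f‖ := by
      intro M hM
      rw [boxAvg_eq_norm hM f, Complex.ofReal_re, Complex.norm_real, norm_norm]
    have hpair : ∀ ii, pairSubgroups (s + 1) H ii ≠ 0 := by
      intro ii
      rw [pairSubgroups_succ]
      intro h
      have := congrArg Multiset.card h
      simp at this
    have hL : ∀ i, ((boxAvg (univ.val.map (H i)) f).re ^ ((1 : ℝ) / 2 ^ (s + 1))) ^ 2 ^ (s + 1) =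
        ‖boxAvg (∑ j, {H i j}) f‖ := by
      intro i
      have h1 : univ.val.map (H i) = ∑ j, {H i j} :=
        (Multiset.sum_map_singleton _).symm.trans (by rw [Multiset.map_map]; rfl)
      rw [h1, hre (by rw [Fin.sum_univ_succ]; simp), one_div,
        ← Nat.cast_ofNat (R := ℝ), ← Nat.cast_pow, Real.rpow_inv_natCast_pow (norm_nonneg _)
          (by positivity)]
    have key := expect_norm_boxAvg_pow_concatExp_le (s + 1) 0 H (fun _ => 0) (fun _ => rfl) 0 hf
    simp only [zero_add, add_zero, sum_const_zero] at key
    simp only [hL, hre (hpair _)]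
    refine key.trans (expect_le_expect fun ii _ => ?_)
    refine Real.self_le_rpow_of_le_one (norm_nonneg _) (norm_boxAvg_le_one _ f hf) ?_
    rw [div_le_one (by positivity)]
    exact one_le_pow₀ one_le_two

end
end
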